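/- arXiv:2108.03258 — 2 statements merged into one kernel-verified Lean document; each statement's English description precedes it below -/
import Mathlib

section
/- Let T > R > P > S be reals with 2R > T + S and let γ ∈ [0,1). Then the following four inequalities hold simultaneously if and only if γ² > (T−R)/(T−P): (i) R/(1−γ) > T + γR/(1−γ²) + γ²P/(1−γ²); (ii) R/(1−γ²) + γP/(1−γ²) > T + γP/(1−γ); (iii) S + γR/(1−γ²) + γ²P/(1−γ²) < P/(1−γ²) + γR/(1−γ²); (iv) S + γP/(1−γ) < P/(1−γ). (These are the self-consistency conditions for the retarded Grim strategy; (iii) and (iv) hold for all γ ∈ [0,1).) -/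
/-- the self-consistency conditions for the retarded Grim strategy hold
simultaneously if and only if `γ² > (T−R)/(T−P)`. -/
theorem stmt_8 (R S T P γ : ℝ) (hTR : T > R) (hRP : R > P) (hPS : P > S)
    (h2R : 2 * R > T + S) (hγ0 : 0 ≤ γ) (hγ1 : γ < 1) :
    (R / (1 - γ) > T + γ * R / (1 - γ ^ 2) + γ ^ 2 * P / (1 - γ ^ 2) ∧
      R / (1 - γ ^ 2) + γ * P / (1 - γ ^ 2) > T + γ * P / (1 - γ) ∧
      S + γ * R / (1 - γ ^ 2) + γ ^ 2 * P / (1 - γ ^ 2) <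
        P / (1 - γ ^ 2) + γ * R / (1 - γ ^ 2) ∧
      S + γ * P / (1 - γ) < P / (1 - γ)) ↔
    γ ^ 2 > (T - R) / (T - P) := by
  have hd : 0 < 1 - γ := by linarith
  have hd₂ : 0 < 1 - γ ^ 2 := by nlinarith
  have hinv (x : ℝ) : x / (1 - γ) = x * (1 + γ) / (1 - γ ^ 2) := by
    rw [div_eq_div_iff hd.ne' hd₂.ne']
    ring
  have hcooperate : R / (1 - γ) - (T + γ * R / (1 - γ ^ 2) + γ ^ 2 * P / (1 - γ ^ 2)) =
      (γ ^ 2 * (T - P) - (T - R)) / (1 - γ ^ 2) := by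
    rw [hinv]
    field_simp
    ring
  have hretard : R / (1 - γ ^ 2) + γ * P / (1 - γ ^ 2) - (T + γ * P / (1 - γ)) =
      (γ ^ 2 * (T - P) - (T - R)) / (1 - γ ^ 2) := by
    rw [hinv]
    field_simp
    ring
  have hpunish : P / (1 - γ ^ 2) = P + γ ^ 2 * P / (1 - γ ^ 2) := by
    field_simp
    ring
  have hdefect : P / (1 - γ) = P + γ * P / (1 - γ) := by
    field_simp
    ring
  rw [gt_iff_lt (x := γ ^ 2), div_lt_iff₀ (by linarith : 0 < T - P)]
  constructor
  · rintro ⟨h, -⟩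
    rw [gt_iff_lt, ← sub_pos, hcooperate, div_pos_iff_of_pos_right hd₂] at h
    linarith
  · intro h
    have hpos : 0 < (γ ^ 2 * (T - P) - (T - R)) / (1 - γ ^ 2) :=
      div_pos (by linarith) hd₂
    refine ⟨?_, ?_, ?_, ?_⟩ <;> linarith
end

section
/- Let T > R > P > S be reals with 2R > T + S and let γ ∈ [0,1). Then the following four inequalities hold simultaneously if and only if γ² > (T−R)/(R−P): (i) R/(1−γ) > T + γR + γ²P + γ³R/(1−γ); (ii) R + γP + γ²R/(1−γ) > T + γP + γ²P + γ³R/(1−γ); (iii) S + γR + γ²P + γ³R/(1−γ) < P + γR/(1−γ); (iv) S + γP + γ²P + γ³R/(1−γ) < P + γP + γ²R/(1−γ). (These are the self-consistency conditions for the retarded WSLS strategy; (iii) and (iv) hold for all γ ∈ [0,1).) -/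
/-- the self-consistency conditions for the retarded WSLS strategy hold
simultaneously if and only if `γ² > (T−R)/(R−P)`. -/
theorem stmt_11 (R S T P γ : ℝ) (hTR : T > R) (hRP : R > P) (hPS : P > S)
    (h2R : 2 * R > T + S) (hγ0 : 0 ≤ γ) (hγ1 : γ < 1) :
    (R / (1 - γ) > T + γ * R + γ ^ 2 * P + γ ^ 3 * R / (1 - γ) ∧
      R + γ * P + γ ^ 2 * R / (1 - γ) >
        T + γ * P + γ ^ 2 * P + γ ^ 3 * R / (1 - γ) ∧
      S + γ * R + γ ^ 2 * P + γ ^ 3 * R / (1 - γ) < P + γ * R / (1 - γ) ∧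
      S + γ * P + γ ^ 2 * P + γ ^ 3 * R / (1 - γ) <
        P + γ * P + γ ^ 2 * R / (1 - γ)) ↔
    γ ^ 2 > (T - R) / (R - P) := by
  have hγ : 1 - γ ≠ 0 := by linarith
  have hd : 0 < R - P := sub_pos.mpr hRP
  have e0 : R / (1 - γ) = R + γ * R + γ ^ 2 * R + γ ^ 3 * R / (1 - γ) := by
    field_simp; ring
  have e1 : γ * R / (1 - γ) = γ * R + γ ^ 2 * R + γ ^ 3 * R / (1 - γ) := by
    field_simp; ring
  have e2 : γ ^ 2 * R / (1 - γ) = γ ^ 2 * R + γ ^ 3 * R / (1 - γ) := by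
    field_simp; ring
  have hnonneg : 0 ≤ γ ^ 2 * (R - P) := by positivity
  rw [e0, e1, e2, gt_iff_lt (x := γ ^ 2), div_lt_iff₀ hd]
  constructor
  · rintro ⟨h, -⟩
    linarith
  · intro h
    refine ⟨?_, ?_, ?_, ?_⟩ <;> linarith
end
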